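/- Let p_H be a probability density on ℝ^n with finite second moment ∫‖x‖² p_H(x) dx < ∞. Suppose the VP marginals p_t are strictly positive and log p_t is twice differentiable for t > 0, with sup_{x∈ℝ^n} ‖∇² log p_t(x)‖ ≤ L(t) < ∞ for every t > 0 and ∫_δ^T (1 + L(t)) dt < ∞ for all 0 < δ < T < ∞. Assume that for all 0 < δ < T a bijection φ_{δ→T} : ℝ^n → ℝ^n is given which is a flow map of v from time δ to time T and transports p_δ to p_T. Then for every ε > 0 there exists δ₀ > 0 such that for every δ ∈ (0, δ₀] there exists T₀ > δ with ‖p_H·λ − (φ_{δ→T}^{-1})_# γ_n‖_TV < ε for all T ≥ T₀; i.e. lim_{δ→0} lim_{T→∞} ‖p_H·λ − (φ_{δ→T}^{-1})_# γ_n‖_TV = 0. -/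

import Mathlib

open MeasureTheory Real Filter Set
open scoped ENNReal Topology RealInnerProductSpace Classical

noncomputable section

/-- Gaussian density kernel with covariance `s2 • I`. -/
def gaussKernel (n : ℕ) (s2 : ℝ) (z : EuclideanSpace ℝ (Fin n)) : ℝ :=
  (2 * π * s2) ^ (-(n : ℝ) / 2) * Real.exp (-‖z‖ ^ 2 / (2 * s2))

/-- VP diffusion marginal `p_t`, with `p_0 = p_H`. -/
def vpMarginal (n : ℕ) (pH : EuclideanSpace ℝ (Fin n) → ℝ) (t : ℝ)
    (x : EuclideanSpace ℝ (Fin n)) : ℝ :=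
  if t = 0 then pH x
  else ∫ y, pH y * gaussKernel n (1 - Real.exp (-t)) (x - Real.exp (-t / 2) • y)

/-- The measure with Lebesgue density `p`. -/
def densMeasure (n : ℕ) (p : EuclideanSpace ℝ (Fin n) → ℝ) :
    Measure (EuclideanSpace ℝ (Fin n)) :=
  volume.withDensity fun x => ENNReal.ofReal (p x)

/-- The standard Gaussian measure `γ_n`. -/
def stdGaussian (n : ℕ) : Measure (EuclideanSpace ℝ (Fin n)) :=
  densMeasure n (gaussKernel n 1)

/-- Score function `s_t = ∇ log p_t`. -/
def score (n : ℕ) (pH : EuclideanSpace ℝ (Fin n) → ℝ) (t : ℝ)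
    (x : EuclideanSpace ℝ (Fin n)) : EuclideanSpace ℝ (Fin n) :=
  gradient (fun z => Real.log (vpMarginal n pH t z)) x

/-- Probability-flow vector field `v_t(x) = -x/2 - s_t(x)/2`. -/
def vField (n : ℕ) (pH : EuclideanSpace ℝ (Fin n) → ℝ) (t : ℝ)
    (x : EuclideanSpace ℝ (Fin n)) : EuclideanSpace ℝ (Fin n) :=
  -(2 : ℝ)⁻¹ • x - (2 : ℝ)⁻¹ • score n pH t x

/-- `φ` is a flow map of `v` from time `s` to time `T`. -/
def IsFlowMap (n : ℕ)
    (v : ℝ → EuclideanSpace ℝ (Fin n) → EuclideanSpace ℝ (Fin n)) (s T : ℝ)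
    (φ : EuclideanSpace ℝ (Fin n) → EuclideanSpace ℝ (Fin n)) : Prop :=
  ∀ x, ∃ γ : ℝ → EuclideanSpace ℝ (Fin n),
    γ s = x ∧ (∀ t ∈ Set.Icc s T, HasDerivAt γ (v t (γ t)) t) ∧ γ T = φ x

/-- Total variation norm `‖μ - ν‖_TV` of the difference of two finite measures. -/
def tvDist {α : Type*} [MeasurableSpace α] (μ ν : Measure α) : ℝ≥0∞ :=
  (⨆ (s : Set α) (_ : MeasurableSet s), μ s - ν s) +
    (⨆ (s : Set α) (_ : MeasurableSet s), ν s - μ s)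

/-- Kullback–Leibler divergence. -/
def klDiv {α : Type*} [MeasurableSpace α] (μ ν : Measure α) : ℝ≥0∞ :=
  if μ ≪ ν ∧ Integrable (llr μ ν) μ then ENNReal.ofReal (∫ x, llr μ ν x ∂μ) else ⊤

/-- A real function is twice differentiable. -/
def TwiceDiff {E : Type*} [NormedAddCommGroup E] [NormedSpace ℝ E] (f : E → ℝ) : Prop :=
  Differentiable ℝ f ∧ Differentiable ℝ (fderiv ℝ f)

/-- Hessian of a real function as a continuous bilinear map. -/
def hessian {E : Type*} [NormedAddCommGroup E] [NormedSpace ℝ E] (f : E → ℝ) (x : E) :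
    E →L[ℝ] E →L[ℝ] ℝ :=
  fderiv ℝ (fderiv ℝ f) x

/-- A map is bi-Lipschitz. -/
def BiLipschitz {E : Type*} [NormedAddCommGroup E] (φ : E → E) : Prop :=
  ∃ c C : ℝ, 0 < c ∧ c ≤ C ∧
    ∀ x y, c * ‖x - y‖ ≤ ‖φ x - φ y‖ ∧ ‖φ x - φ y‖ ≤ C * ‖x - y‖

/-- Centered Gaussian density with covariance matrix `S`. -/
def gaussMat (n : ℕ) (S : Matrix (Fin n) (Fin n) ℝ) (z : EuclideanSpace ℝ (Fin n)) : ℝ :=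
  ((2 * π) ^ n * S.det) ^ (-(1 : ℝ) / 2) *
    Real.exp (-(∑ i, z i * S⁻¹.mulVec (fun j => z j) i) / 2)

end


lemma inv_aux {E : Type*} [MeasurableSpace E] [StandardBorelSpace E] [Nonempty E]
    (μ : Measure E) (φ : E → E) (hb : Function.Bijective φ) (hm : AEMeasurable φ μ) :
    AEMeasurable (Function.invFun φ) (Measure.map φ μ) ∧
      Measure.map (Function.invFun φ) (Measure.map φ μ) = μ := by
  have hleft : ∀ x, Function.invFun φ (φ x) = x := Function.leftInverse_invFun hb.1
  have key : AEMeasurable (Function.invFun φ) (Measure.map φ μ) := by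
    obtain ⟨g, hg, hfg⟩ := hm
    have hm : AEMeasurable φ μ := ⟨g, hg, hfg⟩
    set N := toMeasurable μ {x | φ x ≠ g x} with hN
    have hN0 : μ N = 0 := by rw [hN, measure_toMeasurable]; exact hfg
    have hNm : MeasurableSet N := measurableSet_toMeasurable _ _
    have heq : ∀ x ∈ Nᶜ, φ x = g x := by
      intro x hx
      by_contra h
      exact hx (subset_toMeasurable μ _ h)
    have himg : ∀ A, A ⊆ Nᶜ → MeasurableSet A → MeasurableSet (φ '' A) := by
      intro A hA hAm
      have : φ '' A = g '' A := Set.image_congr fun x hx => heq x (hA hx)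
      rw [this]
      refine hAm.image_of_measurable_injOn hg ?_
      intro x hx y hy hxy
      apply hb.1
      rw [heq x (hA hx), heq y (hA hy), hxy]
    have hS : MeasurableSet (φ '' Nᶜ) := himg _ subset_rfl hNm.compl
    have hnull : ∀ᵐ y ∂(Measure.map φ μ), y ∈ φ '' Nᶜ := by
      rw [ae_iff]
      have : {a | ¬ a ∈ φ '' Nᶜ} = (φ '' Nᶜ)ᶜ := rfl
      rw [this, Measure.map_apply_of_aemeasurable hm hS.compl, Set.preimage_compl,
        Set.preimage_image_eq _ hb.1, compl_compl, hN0]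
    rw [← Measure.restrict_eq_self_of_ae_mem hnull]
    apply aemeasurable_restrict_of_measurable_subtype hS
    intro B hB
    have : ((fun x : (φ '' Nᶜ) => Function.invFun φ x) ⁻¹' B)
        = Subtype.val ⁻¹' (φ '' (Nᶜ ∩ B)) := by
      ext ⟨x, y, hy, rfl⟩
      simp only [Set.mem_preimage, hleft, Set.mem_image, Set.mem_inter_iff]
      constructor
      · intro h; exact ⟨y, ⟨hy, h⟩, rfl⟩
      · rintro ⟨z, ⟨_, hz⟩, h⟩; rw [← hb.1 h]; exact hz
    rw [this]
    exact measurable_subtype_coe (himg _ Set.inter_subset_left (hNm.compl.inter hB))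
  refine ⟨key, ?_⟩
  rw [AEMeasurable.map_map_of_aemeasurable key hm]
  have : Function.invFun φ ∘ φ = id := funext hleft
  rw [this, Measure.map_id]

lemma dens_le (n : ℕ) (p q : EuclideanSpace ℝ (Fin n) → ℝ) (hp : Integrable p)
    (hq : Integrable q) (s : Set (EuclideanSpace ℝ (Fin n))) :
    densMeasure n p s ≤ densMeasure n q s + ENNReal.ofReal (∫ x, |p x - q x|) := by
  have h1 : densMeasure n p ≤ densMeasure n q + densMeasure n (fun x => |p x - q x|) := by
    unfold densMeasure
    refine Measure.le_iff.2 fun u hu => ?_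
    rw [Measure.add_apply, withDensity_apply _ hu, withDensity_apply _ hu, withDensity_apply _ hu,
      ← lintegral_add_right']
    · apply lintegral_mono
      intro x
      simp only
      refine le_trans ?_ ENNReal.ofReal_add_le
      apply ENNReal.ofReal_le_ofReal
      linarith [le_abs_self (p x - q x)]
    · exact (hp.sub hq).abs.aestronglyMeasurable.aemeasurable.ennreal_ofReal.restrict
  refine (h1 s).trans ?_
  rw [Measure.add_apply]
  gcongr
  refine (measure_mono (Set.subset_univ s)).trans ?_
  unfold densMeasure
  rw [withDensity_apply _ MeasurableSet.univ, Measure.restrict_univ]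
  have hi : Integrable (fun x => |p x - q x|) := (hp.sub hq).abs
  rw [ofReal_integral_eq_lintegral_ofReal hi (Eventually.of_forall fun x => abs_nonneg _)]

lemma gk_nonneg (n : ℕ) {s : ℝ} (hs : 0 < s) (z : EuclideanSpace ℝ (Fin n)) :
    0 ≤ gaussKernel n s z := by
  unfold gaussKernel; positivity

lemma gk_cont (n : ℕ) (s : ℝ) : Continuous (gaussKernel n s) := by
  unfold gaussKernel; fun_prop

lemma gk_int (n : ℕ) {s : ℝ} (hs : 0 < s) :
    Integrable (gaussKernel n s) ∧ ∫ z, gaussKernel n s z = 1 := by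
  have hb : 0 < 1 / (2 * s) := by positivity
  have h := GaussianFourier.integral_rexp_neg_mul_sq_norm (V := EuclideanSpace ℝ (Fin n)) hb
  have hI : Integrable (fun v : EuclideanSpace ℝ (Fin n) => rexp (-(1 / (2 * s)) * ‖v‖ ^ 2)) := by
    by_contra hc
    rw [integral_undef hc] at h
    have : 0 < (π / (1 / (2 * s))) ^ (Module.finrank ℝ (EuclideanSpace ℝ (Fin n)) / 2 : ℝ) := by
      positivity
    linarith
  have he : gaussKernel n s = fun v => (2 * π * s) ^ (-(n : ℝ) / 2) *
      rexp (-(1 / (2 * s)) * ‖v‖ ^ 2) := by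
    funext v; unfold gaussKernel; congr 2; field_simp
  rw [he]
  refine ⟨hI.const_mul _, ?_⟩
  rw [integral_const_mul, h, finrank_euclideanSpace_fin]
  have : π / (1 / (2 * s)) = 2 * π * s := by field_simp
  rw [this, ← rpow_add (by positivity)]
  rw [show -(n : ℝ) / 2 + n / 2 = 0 by ring, rpow_zero]

lemma s_pos {t : ℝ} (ht : 0 < t) : 0 < 1 - rexp (-t) := by
  have : rexp (-t) < 1 := by rw [exp_lt_one_iff]; linarith
  linarith

lemma vp_prod (n : ℕ) (f : EuclideanSpace ℝ (Fin n) → ℝ) (hf : Integrable f) {t : ℝ} (ht : 0 < t) :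
    Integrable (Function.uncurry fun x y =>
      f y * gaussKernel n (1 - Real.exp (-t)) (x - Real.exp (-t / 2) • y))
      ((volume : Measure (EuclideanSpace ℝ (Fin n))).prod volume) := by
  have hs := s_pos ht
  obtain ⟨hgi, hg1⟩ := gk_int n hs
  rw [integrable_prod_iff']
  · refine ⟨Eventually.of_forall fun y => ?_, ?_⟩
    · exact (hgi.comp_sub_right (rexp (-t / 2) • y)).const_mul (f y)
    · have : (fun y => ∫ x, ‖(Function.uncurry fun x y =>
          f y * gaussKernel n (1 - Real.exp (-t)) (x - Real.exp (-t / 2) • y)) (x, y)‖)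
          = fun y => ‖f y‖ := by
        funext y
        simp only [Function.uncurry, norm_mul]
        rw [integral_const_mul]
        have : ∫ x, ‖gaussKernel n (1 - rexp (-t)) (x - rexp (-t / 2) • y)‖ = 1 := by
          rw [integral_sub_right_eq_self (fun x => ‖gaussKernel n (1 - rexp (-t)) x‖)]
          refine Eq.trans ?_ hg1
          congr 1; funext x
          exact Real.norm_of_nonneg (gk_nonneg n hs x)
        rw [this, mul_one]
      rw [this]
      exact hf.norm
  · apply AEStronglyMeasurable.mul
    · exact hf.aestronglyMeasurable.comp_snd
    · apply Continuous.aestronglyMeasurable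
      exact (gk_cont n _).comp (by fun_prop)

lemma vp_int (n : ℕ) (f : EuclideanSpace ℝ (Fin n) → ℝ) (hf : Integrable f) {t : ℝ} (ht : 0 < t) :
    Integrable (vpMarginal n f t) ∧ ∫ x, vpMarginal n f t x = ∫ x, f x := by
  have hs := s_pos ht
  obtain ⟨hgi, hg1⟩ := gk_int n hs
  have h := vp_prod n f hf ht
  have he : vpMarginal n f t = fun x => ∫ y, f y * gaussKernel n (1 - Real.exp (-t))
      (x - Real.exp (-t / 2) • y) := by
    funext x; simp [vpMarginal, ht.ne']
  rw [he]
  refine ⟨h.integral_prod_left, ?_⟩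
  rw [integral_integral_swap h]
  congr 1; funext y
  rw [integral_const_mul, integral_sub_right_eq_self (gaussKernel n (1 - rexp (-t))), hg1, mul_one]

lemma vp_integrand (n : ℕ) (f : EuclideanSpace ℝ (Fin n) → ℝ) (hf : Integrable f) {t : ℝ}
    (ht : 0 < t) (x : EuclideanSpace ℝ (Fin n)) : Integrable fun y =>
      f y * gaussKernel n (1 - Real.exp (-t)) (x - Real.exp (-t / 2) • y) := by
  have hs := s_pos ht
  refine hf.mul_bdd (c := (2 * π * (1 - rexp (-t))) ^ (-(n : ℝ) / 2)) ?_ (Eventually.of_forall fun y => ?_)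
  · exact ((gk_cont n _).comp (by fun_prop)).aestronglyMeasurable
  · rw [Real.norm_of_nonneg (gk_nonneg n hs _)]
    unfold gaussKernel
    apply mul_le_of_le_one_right (by positivity)
    rw [exp_le_one_iff]
    apply div_nonpos_of_nonpos_of_nonneg
    · simp
    · positivity

lemma vp_contr (n : ℕ) (f g : EuclideanSpace ℝ (Fin n) → ℝ) (hf : Integrable f)
    (hg : Integrable g) {t : ℝ} (ht : 0 < t) :
    ∫ x, |vpMarginal n f t x - vpMarginal n g t x| ≤ ∫ x, |f x - g x| := by
  have hs := s_pos ht
  rw [← (vp_int n (fun x => |f x - g x|) (hf.sub hg).abs ht).2]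
  have hi : Integrable (fun x => |vpMarginal n f t x - vpMarginal n g t x|) :=
    ((vp_int n f hf ht).1.sub (vp_int n g hg ht).1).abs
  apply integral_mono hi (vp_int n (fun x => |f x - g x|) (hf.sub hg).abs ht).1
  intro x
  simp only [vpMarginal, ht.ne', if_false]
  rw [← integral_sub (vp_integrand n f hf ht x) (vp_integrand n g hg ht x)]
  refine abs_integral_le_integral_abs.trans (le_of_eq ?_)
  congr 1; funext y
  rw [← sub_mul, abs_mul, abs_of_nonneg (gk_nonneg n hs _)]

lemma scheffe_aux {E : Type*} [MeasurableSpace E] (μ : Measure E) (l : Filter ℝ)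
    [l.IsCountablyGenerated] (P : ℝ → E → ℝ) (p : E → ℝ)
    (hp : Integrable p μ) (hp0 : ∀ x, 0 ≤ p x)
    (hP : ∀ᶠ t in l, Integrable (P t) μ ∧ (∀ x, 0 ≤ P t x) ∧ ∫ x, P t x ∂μ = ∫ x, p x ∂μ)
    (hlim : ∀ x, Tendsto (fun t => P t x) l (𝓝 (p x))) :
    Tendsto (fun t => ∫ x, |p x - P t x| ∂μ) l (𝓝 0) := by
  have h1 : Tendsto (fun t => ∫ x, max (p x - P t x) 0 ∂μ) l (𝓝 (∫ x, (0 : ℝ) ∂μ)) := by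
    refine tendsto_integral_filter_of_dominated_convergence p ?_ ?_ hp ?_
    · filter_upwards [hP] with t ht
      exact (hp.sub ht.1).pos_part.aestronglyMeasurable
    · filter_upwards [hP] with t ht
      refine Eventually.of_forall fun x => ?_
      rw [Real.norm_of_nonneg (le_max_right _ _)]
      exact max_le (by linarith [ht.2.1 x]) (hp0 x)
    · refine Eventually.of_forall fun x => ?_
      have : Tendsto (fun t => max (p x - P t x) 0) l (𝓝 (max (p x - p x) 0)) :=
        (tendsto_const_nhds.sub (hlim x)).max tendsto_const_nhds
      simpa using this
  have h2 : Tendsto (fun t => 2 * ∫ x, max (p x - P t x) 0 ∂μ) l (𝓝 0) := by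
    simpa using h1.const_mul 2
  refine h2.congr' ?_
  filter_upwards [hP] with t ht
  have : ∀ x, |p x - P t x| = 2 * max (p x - P t x) 0 - (p x - P t x) := by
    intro x
    rcases le_total (p x - P t x) 0 with h | h
    · rw [abs_of_nonpos h, max_eq_right h]; ring
    · rw [abs_of_nonneg h, max_eq_left h]; ring
  simp_rw [this]
  have h3 : Integrable (fun x => p x - P t x) μ := hp.sub ht.1
  rw [integral_sub (h3.pos_part.const_mul 2) h3, integral_const_mul, integral_sub hp ht.1, ht.2.2]
  ring

lemma vp_nonneg (n : ℕ) (f : EuclideanSpace ℝ (Fin n) → ℝ) (hf : ∀ x, 0 ≤ f x) {t : ℝ}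
    (ht : 0 < t) (x : EuclideanSpace ℝ (Fin n)) : 0 ≤ vpMarginal n f t x := by
  simp only [vpMarginal, ht.ne', if_false]
  exact integral_nonneg fun y => mul_nonneg (hf y) (gk_nonneg n (s_pos ht) _)

lemma lim_top (n : ℕ) (f : EuclideanSpace ℝ (Fin n) → ℝ) (hf : Integrable f)
    (hf0 : ∀ x, 0 ≤ f x) (hf1 : ∫ x, f x = 1) :
    Tendsto (fun t => ∫ x, |gaussKernel n 1 x - vpMarginal n f t x|) atTop (𝓝 0) := by
  obtain ⟨hgi, hg1⟩ := gk_int n one_pos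
  have hs : Tendsto (fun t : ℝ => 1 - rexp (-t)) atTop (𝓝 1) := by
    have := (tendsto_const_nhds (x := (1:ℝ))).sub
      (Real.tendsto_exp_atBot.comp tendsto_neg_atTop_atBot)
    simpa using this
  have ha : Tendsto (fun t : ℝ => rexp (-t / 2)) atTop (𝓝 0) := by
    apply Real.tendsto_exp_atBot.comp
    exact tendsto_neg_atTop_atBot.atBot_div_const (by norm_num)
  apply scheffe_aux volume atTop _ _ hgi (fun x => gk_nonneg n one_pos x)
  · filter_upwards [eventually_gt_atTop 0] with t ht
    refine ⟨(vp_int n f hf ht).1, fun x => vp_nonneg n f hf0 ht x, ?_⟩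
    rw [(vp_int n f hf ht).2, hf1, hg1]
  · intro x
    have h0 : Tendsto (fun t => ∫ y, f y * gaussKernel n (1 - Real.exp (-t))
      (x - Real.exp (-t / 2) • y)) atTop (𝓝 (∫ y, f y * gaussKernel n 1 x)) := by
      have hC : Tendsto (fun t : ℝ => (2 * π * (1 - rexp (-t))) ^ (-(n : ℝ) / 2)) atTop
          (𝓝 ((2 * π * 1) ^ (-(n : ℝ) / 2))) :=
        (hs.const_mul (2 * π)).rpow_const (Or.inl (by positivity))
      refine tendsto_integral_filter_of_dominated_convergence
        (fun y => |f y| * ((2 * π * 1) ^ (-(n : ℝ) / 2) + 1)) ?_ ?_ (hf.abs.mul_const _) ?_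
      · filter_upwards [eventually_gt_atTop 0] with t ht
        exact (vp_integrand n f hf ht x).aestronglyMeasurable
      · filter_upwards [eventually_gt_atTop 0,
          hC.eventually (gt_mem_nhds (lt_add_one _))] with t ht hCt
        refine Eventually.of_forall fun y => ?_
        rw [norm_mul, Real.norm_eq_abs, Real.norm_of_nonneg (gk_nonneg n (s_pos ht) _)]
        gcongr
        refine le_trans ?_ hCt.le
        have := s_pos ht
        unfold gaussKernel
        apply mul_le_of_le_one_right (by positivity)
        rw [exp_le_one_iff]
        apply div_nonpos_of_nonpos_of_nonneg
        · simp
        · positivity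
      · refine Eventually.of_forall fun y => ?_
        unfold gaussKernel
        refine (hC.mul ?_).const_mul _
        apply (Real.continuous_exp.tendsto _).comp
        apply Tendsto.div _ (hs.const_mul 2) (by norm_num)
        have := ((((tendsto_const_nhds (x := x)).sub (ha.smul_const y)).norm).pow 2).neg
        simpa using this
    rw [integral_mul_const, hf1, one_mul] at h0
    refine h0.congr' ?_
    filter_upwards [eventually_gt_atTop 0] with t ht
    simp [vpMarginal, ht.ne']

lemma vp_subst (n : ℕ) (f : EuclideanSpace ℝ (Fin n) → ℝ) {t : ℝ} (ht : 0 < t)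
    (x : EuclideanSpace ℝ (Fin n)) :
    vpMarginal n f t x = (rexp (-t / 2) ^ n)⁻¹ *
      ∫ z, f ((rexp (-t / 2))⁻¹ • (x - √(1 - rexp (-t)) • z)) * gaussKernel n 1 z := by
  have hs := s_pos ht
  set s := 1 - rexp (-t) with hsdef
  set a := rexp (-t / 2) with hadef
  have ha : 0 < a := exp_pos _
  have hr : 0 < √s := Real.sqrt_pos.2 hs
  set h : EuclideanSpace ℝ (Fin n) → ℝ := fun y => f y * gaussKernel n s (x - a • y) with hh
  have e1 : vpMarginal n f t x = ∫ y, h y := by simp [vpMarginal, ht.ne', hh, hsdef, hadef]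
  have e2 := Measure.integral_comp_smul (volume : Measure (EuclideanSpace ℝ (Fin n))) h a⁻¹
  have e3 := integral_sub_left_eq_self (fun w => h (a⁻¹ • w))
    (volume : Measure (EuclideanSpace ℝ (Fin n))) x
  have e4 := Measure.integral_comp_smul (volume : Measure (EuclideanSpace ℝ (Fin n)))
    (fun w => h (a⁻¹ • (x - w))) (√s)
  rw [finrank_euclideanSpace_fin] at e2 e4
  rw [e3, e2] at e4
  have e5 : ∀ z, f (a⁻¹ • (x - √s • z)) * gaussKernel n 1 z
      = √s ^ n * h (a⁻¹ • (x - √s • z)) := by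
    intro z
    simp only [hh]
    rw [smul_inv_smul₀ ha.ne', sub_sub_cancel]
    have : gaussKernel n 1 z = √s ^ n * gaussKernel n s (√s • z) := by
      unfold gaussKernel
      rw [norm_smul, Real.norm_of_nonneg hr.le, mul_pow, Real.sq_sqrt hs.le, mul_one, mul_one,
        Real.mul_rpow (by positivity) hs.le]
      have h1 : √s ^ n = s ^ ((n : ℝ) / 2) := by
        rw [Real.sqrt_eq_rpow, ← Real.rpow_natCast, ← Real.rpow_mul hs.le]; congr 1; ring
      have h2 : s ^ ((n : ℝ) / 2) * s ^ (-(n : ℝ) / 2) = 1 := by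
        rw [← rpow_add hs, show (n : ℝ) / 2 + -(n : ℝ) / 2 = 0 by ring, rpow_zero]
      have h3 : -(s * ‖z‖ ^ 2) / (2 * s) = -‖z‖ ^ 2 / 2 := by field_simp
      rw [h1, h3]
      linear_combination (-(2 * π) ^ (-(n : ℝ) / 2) * rexp (-‖z‖ ^ 2 / 2)) * h2
    rw [this]; ring
  simp_rw [e5]
  rw [integral_const_mul, e4, e1]
  simp only [smul_eq_mul]
  rw [abs_of_pos (by positivity), abs_of_pos (by positivity), inv_pow, inv_inv]
  field_simp

lemma lim_zero_cc (n : ℕ) (f : EuclideanSpace ℝ (Fin n) → ℝ) (hf : Integrable f)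
    (hf0 : ∀ x, 0 ≤ f x) (hc : Continuous f) (hs : HasCompactSupport f) :
    Tendsto (fun t => ∫ x, |f x - vpMarginal n f t x|) (𝓝[>] 0) (𝓝 0) := by
  obtain ⟨hgi, hg1⟩ := gk_int n one_pos
  apply scheffe_aux volume _ _ _ hf hf0
  · filter_upwards [self_mem_nhdsWithin] with t ht
    exact ⟨(vp_int n f hf ht).1, fun x => vp_nonneg n f hf0 ht x, (vp_int n f hf ht).2⟩
  · intro x
    obtain ⟨C, hC⟩ := hs.exists_bound_of_continuous hc
    have ha : Tendsto (fun t : ℝ => rexp (-t / 2)) (𝓝[>] 0) (𝓝 1) := by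
      have : Continuous (fun t : ℝ => rexp (-t / 2)) := by fun_prop
      have := (this.tendsto 0).mono_left (nhdsWithin_le_nhds (s := Set.Ioi 0))
      simpa using this
    have hr : Tendsto (fun t : ℝ => √(1 - rexp (-t))) (𝓝[>] 0) (𝓝 0) := by
      have : Continuous (fun t : ℝ => √(1 - rexp (-t))) := by fun_prop
      have := (this.tendsto 0).mono_left (nhdsWithin_le_nhds (s := Set.Ioi 0))
      simpa using this
    have h0 : Tendsto (fun t => ∫ z, f ((rexp (-t / 2))⁻¹ • (x - √(1 - rexp (-t)) • z)) *
        gaussKernel n 1 z) (𝓝[>] 0) (𝓝 (∫ z, f x * gaussKernel n 1 z)) := by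
      refine tendsto_integral_filter_of_dominated_convergence
        (fun z => C * gaussKernel n 1 z) ?_ ?_ (hgi.const_mul _) ?_
      · refine Eventually.of_forall fun t => ?_
        exact ((hc.comp (by fun_prop)).mul (gk_cont n 1)).aestronglyMeasurable
      · refine Eventually.of_forall fun t => Eventually.of_forall fun z => ?_
        rw [norm_mul, Real.norm_of_nonneg (gk_nonneg n one_pos z)]
        exact mul_le_mul_of_nonneg_right (hC _) (gk_nonneg n one_pos z)
      · refine Eventually.of_forall fun z => ?_
        refine Tendsto.mul_const _ ?_
        apply (hc.tendsto x).comp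
        have := (ha.inv₀ one_ne_zero).smul ((tendsto_const_nhds (x := x)).sub (hr.smul_const z))
        simpa using this
    rw [integral_const_mul, hg1, mul_one] at h0
    have h1 := ((ha.pow n).inv₀ (by simp)).mul h0
    simp only [one_pow, inv_one, one_mul] at h1
    refine h1.congr' ?_
    filter_upwards [self_mem_nhdsWithin] with t ht
    exact (vp_subst n f ht x).symm

lemma lim_zero (n : ℕ) (p : EuclideanSpace ℝ (Fin n) → ℝ) (hp : Integrable p)
    (hp0 : ∀ x, 0 ≤ p x) (r : ℝ) (hr : 0 < r) :
    ∀ᶠ t in 𝓝[>] (0 : ℝ), ∫ x, |p x - vpMarginal n p t x| < r := by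
  obtain ⟨g, hgs, hgr, hgc, hgi⟩ := hp.exists_hasCompactSupport_integral_sub_le
    (show 0 < r / 3 by positivity)
  set f : EuclideanSpace ℝ (Fin n) → ℝ := fun x => max (g x) 0 with hfdef
  have hfi : Integrable f := hgi.pos_part
  have hfs : HasCompactSupport f := by
    have : f = (fun y : ℝ => max y 0) ∘ g := rfl
    rw [this]
    exact hgs.comp_left (by simp)
  have hfr : ∫ x, |p x - f x| ≤ r / 3 := by
    refine le_trans ?_ hgr
    apply integral_mono (hp.sub hfi).abs (hp.sub hgi).norm
    intro x
    simp only [Real.norm_eq_abs, hfdef]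
    have := abs_max_sub_max_le_abs (p x) (g x) 0
    rwa [max_eq_left (hp0 x)] at this
  have h := lim_zero_cc n f hfi (fun x => le_max_right _ _) (by fun_prop) hfs
  filter_upwards [h.eventually (gt_mem_nhds (show 0 < r / 3 by positivity)),
    self_mem_nhdsWithin] with t h1 ht
  have h2 := vp_contr n f p hfi hp ht
  have hfv := (vp_int n f hfi ht).1
  have hpv := (vp_int n p hp ht).1
  have h3 : ∫ x, |f x - p x| = ∫ x, |p x - f x| := by simp_rw [abs_sub_comm]
  have i1 : Integrable (fun x => |p x - f x|) := (hp.sub hfi).abs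
  have i2 : Integrable (fun x => |f x - vpMarginal n f t x|) := (hfi.sub hfv).abs
  have i3 : Integrable (fun x => |vpMarginal n f t x - vpMarginal n p t x|) := (hfv.sub hpv).abs
  have i4 : Integrable (fun x => |p x - vpMarginal n p t x|) := (hp.sub hpv).abs
  have i12 : Integrable (fun x => |p x - f x| + |f x - vpMarginal n f t x|) := i1.add i2
  have i123 : Integrable (fun x => |p x - f x| + |f x - vpMarginal n f t x|
      + |vpMarginal n f t x - vpMarginal n p t x|) := i12.add i3
  have h4 : ∫ x, |p x - vpMarginal n p t x| ≤ ∫ x, (|p x - f x| + |f x - vpMarginal n f t x|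
      + |vpMarginal n f t x - vpMarginal n p t x|) := by
    apply integral_mono i4 i123
    intro x
    simp only
    have e1 := abs_sub_le (p x) (f x) (vpMarginal n p t x)
    have e2 := abs_sub_le (f x) (vpMarginal n f t x) (vpMarginal n p t x)
    linarith
  rw [integral_add i12 i3, integral_add i1 i2] at h4
  linarith

/-- Theorem 1 (III): under uniform-in-space score regularity with time-integrable bound,
the Gaussian pullbacks of the VP probability-flow transports approximate `p_H` in
total variation, in the iterated limit `δ → 0`, `T → ∞`. -/
theorem stmt_2 (n : ℕ) (pH : EuclideanSpace ℝ (Fin n) → ℝ)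
    (hnn : ∀ x, 0 ≤ pH x) (hint : Integrable pH) (hmass : ∫ x, pH x = 1)
    (hmom : Integrable fun x => ‖x‖ ^ 2 * pH x)
    (hpos : ∀ t > (0 : ℝ), ∀ x, 0 < vpMarginal n pH t x)
    (L : ℝ → ℝ)
    (hreg : ∀ t > (0 : ℝ),
      TwiceDiff (fun x => Real.log (vpMarginal n pH t x)) ∧
      ∀ x, ‖hessian (fun z => Real.log (vpMarginal n pH t z)) x‖ ≤ L t)
    (hLint : ∀ δ T : ℝ, 0 < δ → δ < T →
      IntegrableOn (fun t => 1 + L t) (Set.Icc δ T))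
    (φ : ℝ → ℝ → EuclideanSpace ℝ (Fin n) → EuclideanSpace ℝ (Fin n))
    (hφ : ∀ δ T : ℝ, 0 < δ → δ < T →
      Function.Bijective (φ δ T) ∧
      IsFlowMap n (vField n pH) δ T (φ δ T) ∧
      Measure.map (φ δ T) (densMeasure n (vpMarginal n pH δ)) =
        densMeasure n (vpMarginal n pH T)) :
    ∀ ε : ℝ≥0∞, 0 < ε → ∃ δ₀ > (0 : ℝ), ∀ δ : ℝ, 0 < δ → δ ≤ δ₀ →
      ∃ T₀ > δ, ∀ T ≥ T₀,
        tvDist (densMeasure n pH)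
          (Measure.map (Function.invFun (φ δ T)) (stdGaussian n)) < ε := by
  intro ε hε
  obtain ⟨r, hr0, hrε⟩ := ENNReal.lt_iff_exists_nnreal_btwn.1 hε
  have hr : (0 : ℝ) < r := by exact_mod_cast hr0
  have hr5 : (0 : ℝ) < r / 4 := by positivity
  obtain ⟨d, hd, hd2⟩ := mem_nhdsGT_iff_exists_Ioc_subset.1 (lim_zero n pH hint hnn (r / 4) hr5)
  refine ⟨d, hd, fun δ hδ hδd => ?_⟩
  have hA : ∫ x, |pH x - vpMarginal n pH δ x| < r / 4 := hd2 ⟨hδ, hδd⟩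
  obtain ⟨T1, hT1⟩ := eventually_atTop.1
    ((lim_top n pH hint hnn hmass).eventually (gt_mem_nhds hr5))
  refine ⟨max T1 (δ + 1), lt_of_lt_of_le (by linarith) (le_max_right _ _), fun T hT => ?_⟩
  have hB := hT1 T ((le_max_left _ _).trans hT)
  have hδT : δ < T := by linarith [(le_max_right T1 (δ + 1)).trans hT]
  have hT0 : 0 < T := hδ.trans hδT
  obtain ⟨hbij, -, hmap⟩ := hφ δ T hδ hδT
  have hiδ := (vp_int n pH hint hδ).1
  have hiT := (vp_int n pH hint hT0).1
  have hig := (gk_int n one_pos).1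
  have hvac : (volume : Measure (EuclideanSpace ℝ (Fin n))) ≪
      densMeasure n (vpMarginal n pH T) := by
    apply withDensity_absolutelyContinuous'
    · exact hiT.aestronglyMeasurable.aemeasurable.ennreal_ofReal
    · refine Eventually.of_forall fun x => ?_
      simpa using hpos T hT0 x
  have hae : AEMeasurable (φ δ T) (densMeasure n (vpMarginal n pH δ)) := by
    by_contra hc
    rw [Measure.map_of_not_aemeasurable hc] at hmap
    rw [← hmap] at hvac
    have h0 : (volume : Measure (EuclideanSpace ℝ (Fin n))) Set.univ = 0 := hvac rfl
    rw [Measure.measure_univ_eq_zero] at h0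
    exact NeZero.ne _ h0
  obtain ⟨hψ, hψmap⟩ := inv_aux _ _ hbij hae
  rw [hmap] at hψ hψmap
  have hgac : stdGaussian n ≪ densMeasure n (vpMarginal n pH T) :=
    (withDensity_absolutelyContinuous _ _).trans hvac
  have hψg : AEMeasurable (Function.invFun (φ δ T)) (stdGaussian n) := hψ.mono_ac hgac
  set ψ := Function.invFun (φ δ T)
  have hE : ENNReal.ofReal (∫ x, |pH x - vpMarginal n pH δ x|) +
      ENNReal.ofReal (∫ x, |gaussKernel n 1 x - vpMarginal n pH T x|) ≤
      ENNReal.ofReal (r / 2) := by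
    rw [← ENNReal.ofReal_add (integral_nonneg fun x => abs_nonneg _)
      (integral_nonneg fun x => abs_nonneg _)]
    apply ENNReal.ofReal_le_ofReal
    linarith
  have k1 : ∀ s, MeasurableSet s →
      densMeasure n pH s ≤ Measure.map ψ (stdGaussian n) s + ENNReal.ofReal (r / 2) := by
    intro s hs
    have a1 := dens_le n _ _ hint hiδ s
    have a2 := dens_le n _ _ hiT hig (ψ ⁻¹' s)
    rw [← Measure.map_apply_of_aemeasurable hψ hs, hψmap] at a2
    simp_rw [abs_sub_comm (vpMarginal n pH T _)] at a2
    rw [Measure.map_apply_of_aemeasurable hψg hs]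
    refine le_trans ?_ (add_le_add le_rfl hE)
    refine a1.trans ((add_le_add a2 le_rfl).trans (le_of_eq ?_))
    unfold stdGaussian
    ring
  have k2 : ∀ s, MeasurableSet s →
      Measure.map ψ (stdGaussian n) s ≤ densMeasure n pH s + ENNReal.ofReal (r / 2) := by
    intro s hs
    have a1 := dens_le n _ _ hiδ hint s
    have a2 := dens_le n _ _ hig hiT (ψ ⁻¹' s)
    rw [← Measure.map_apply_of_aemeasurable hψ hs, hψmap] at a2
    simp_rw [abs_sub_comm (vpMarginal n pH δ _)] at a1
    rw [Measure.map_apply_of_aemeasurable hψg hs]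
    refine le_trans ?_ (add_le_add le_rfl hE)
    refine le_trans a2 ((add_le_add a1 le_rfl).trans (le_of_eq ?_))
    ring
  refine lt_of_le_of_lt ?_ hrε
  unfold tvDist
  refine (add_le_add (iSup₂_le fun s hs => tsub_le_iff_left.2 (k1 s hs))
    (iSup₂_le fun s hs => tsub_le_iff_left.2 (k2 s hs))).trans ?_
  rw [← ENNReal.ofReal_add (by positivity) (by positivity), add_halves, ENNReal.ofReal_coe_nnreal]
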